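/- Let m ≥ 1 and let l1, l2 be integers with 0 ≤ l2 < l1 ≤ m. The number of ordered pairs (u,v) of binary words of length m with |u|_a = l1 and |v|_a = l2 such that for every t with 1 ≤ t ≤ m the prefix of u of length t is not abelian equivalent to the prefix of v of length t, equals ((l1 − l2)/m)·C(m, l1)·C(m, l2), which is a nonnegative integer. -/

import Mathlib

/-- Abelian equivalence of binary words; the alphabet `{a, b}` is encoded by
`Bool` with `a = true` and `b = false`. -/
def AbEq (x y : List Bool) : Prop :=
  x.count true = y.count true ∧ x.count false = y.count false

def Aset (m : ℕ) (i j : ℤ) : Set (List Bool × List Bool) :=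
  {p : List Bool × List Bool | p.1.length = m ∧ p.2.length = m ∧
        (p.1.count true : ℤ) = i ∧ (p.2.count true : ℤ) = j ∧
        ∀ t, 1 ≤ t → t ≤ m → ¬ AbEq (p.1.take t) (p.2.take t)}

def snocP (x y : Bool) (p : List Bool × List Bool) : List Bool × List Bool :=
  (p.1 ++ [x], p.2 ++ [y])

def bz (x : Bool) : ℤ := if x then 1 else 0

def cz : ℕ → ℤ → ℤ
  | 0, k => if k = 0 then 1 else 0
  | n + 1, k => cz n k + cz n (k - 1)

theorem cz_neg (n : ℕ) (k : ℤ) (h : k < 0) : cz n k = 0 := by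
  induction n generalizing k with
  | zero => simp [cz]; omega
  | succ n ih => rw [cz, ih k h, ih (k - 1) (by omega)]; rfl

theorem cz_nat (n k : ℕ) : cz n (k : ℤ) = (n.choose k : ℤ) := by
  induction n generalizing k with
  | zero => cases k with
    | zero => simp [cz]
    | succ k => simp [cz]; omega
  | succ n ih => cases k with
    | zero => rw [cz, ih 0, cz_neg _ _ (by simp)]; simp
    | succ k =>
      rw [cz, ih (k + 1), show ((k + 1 : ℕ) : ℤ) - 1 = (k : ℤ) by push_cast; ring, ih k,
        Nat.choose_succ_succ]
      push_cast; ring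

theorem snocP_inj (x y : Bool) : Function.Injective (snocP x y) := by
  rintro ⟨u, v⟩ ⟨u', v'⟩ h
  simpa [snocP] using h

theorem snocP_disj (x y x' y' : Bool) (h : ¬ (x = x' ∧ y = y'))
    (S T : Set (List Bool × List Bool)) : Disjoint (snocP x y '' S) (snocP x' y' '' T) := by
  rw [Set.disjoint_left]
  rintro _ ⟨p, _, rfl⟩ ⟨q, _, hq⟩
  simp only [snocP, Prod.mk.injEq] at hq
  apply h
  have h1 := List.append_inj_right' hq.1 rfl
  have h2 := List.append_inj_right' hq.2 rfl
  simp at h1 h2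
  exact ⟨h1.symm, h2.symm⟩

theorem Aset_fin (m : ℕ) (i j : ℤ) : (Aset m i j).Finite := by
  apply ((List.finite_length_eq Bool m).prod (List.finite_length_eq Bool m)).subset
  rintro p ⟨h1, h2, _⟩
  exact ⟨h1, h2⟩

theorem abEq_iff (x y : List Bool) (h : x.length = y.length) :
    AbEq x y ↔ x.count true = y.count true := by
  have hx := List.count_true_add_count_false x
  have hy := List.count_true_add_count_false y
  unfold AbEq
  omega

theorem mem_snoc (m : ℕ) (i j : ℤ) (hij : i ≠ j) (x y : Bool) (p : List Bool × List Bool) :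
    snocP x y p ∈ Aset (m + 1) i j ↔ p ∈ Aset m (i - bz x) (j - bz y) := by
  obtain ⟨u, v⟩ := p
  have hc : ∀ (x : Bool) (w : List Bool), ((w ++ [x]).count true : ℤ) = w.count true + bz x := by
    intro x w; cases x <;> simp [bz]
  simp only [snocP, Aset, Set.mem_ofPred_eq, hc, List.length_append, List.length_singleton]
  constructor
  · rintro ⟨h1, h2, h3, h4, h5⟩
    refine ⟨by omega, by omega, by omega, by omega, fun t ht1 ht2 => ?_⟩
    have := h5 t ht1 (by omega)
    rwa [List.take_append_of_le_length (l₁ := u) (by omega),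
      List.take_append_of_le_length (l₁ := v) (by omega)] at this
  · rintro ⟨h1, h2, h3, h4, h5⟩
    refine ⟨by omega, by omega, by omega, by omega, fun t ht1 ht2 => ?_⟩
    rcases Nat.lt_or_ge m t with h | h
    · rw [List.take_of_length_le (l := u ++ [x]) (by simp; omega),
        List.take_of_length_le (l := v ++ [y]) (by simp; omega),
        abEq_iff _ _ (by simp; omega)]
      have e1 := hc x u
      have e2 := hc y v
      omega
    · rw [List.take_append_of_le_length (l₁ := u) (by omega),
        List.take_append_of_le_length (l₁ := v) (by omega)]
      exact h5 t ht1 h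

theorem Aset_succ (m : ℕ) (i j : ℤ) (hij : i ≠ j) :
    Aset (m + 1) i j = (snocP false false '' Aset m i j ∪ snocP true false '' Aset m (i - 1) j) ∪
      (snocP false true '' Aset m i (j - 1) ∪ snocP true true '' Aset m (i - 1) (j - 1)) := by
  have key := mem_snoc m i j hij
  ext p
  constructor
  · intro hp
    obtain ⟨u, v⟩ := p
    have hu : u ≠ [] := by rintro rfl; have := hp.1; simp at this
    have hv : v ≠ [] := by rintro rfl; have := hp.2.1; simp at this
    have e : (u, v) = snocP (u.getLast hu) (v.getLast hv) (u.dropLast, v.dropLast) := by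
      simp only [snocP, List.dropLast_append_getLast]
    rw [e] at hp ⊢
    generalize u.getLast hu = x at *
    generalize v.getLast hv = y at *
    have hq := (key _ _ _).1 hp
    cases x <;> cases y <;> simp only [bz, if_true, if_false, sub_zero, Bool.false_eq_true] at hq
    · exact Or.inl (Or.inl ⟨_, hq, rfl⟩)
    · exact Or.inr (Or.inl ⟨_, hq, rfl⟩)
    · exact Or.inl (Or.inr ⟨_, hq, rfl⟩)
    · exact Or.inr (Or.inr ⟨_, hq, rfl⟩)
  · rintro ((⟨q, hq, rfl⟩ | ⟨q, hq, rfl⟩) | (⟨q, hq, rfl⟩ | ⟨q, hq, rfl⟩)) <;>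
      exact (key _ _ _).2 (by simpa [bz] using hq)

theorem Aset_card_succ (m : ℕ) (i j : ℤ) (hij : i ≠ j) :
    (Aset (m + 1) i j).ncard = ((Aset m i j).ncard + (Aset m (i - 1) j).ncard) +
      ((Aset m i (j - 1)).ncard + (Aset m (i - 1) (j - 1)).ncard) := by
  have f : ∀ x y i j, (snocP x y '' Aset m i j).Finite := fun x y i j => (Aset_fin m i j).image _
  rw [Aset_succ m i j hij, Set.ncard_union_eq _ ((f _ _ _ _).union (f _ _ _ _))
    ((f _ _ _ _).union (f _ _ _ _)), Set.ncard_union_eq _ (f _ _ _ _) (f _ _ _ _),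
    Set.ncard_union_eq _ (f _ _ _ _) (f _ _ _ _)]
  · simp only [Set.ncard_image_of_injective _ (snocP_inj _ _)]
  · exact snocP_disj _ _ _ _ (by simp) _ _
  · exact snocP_disj _ _ _ _ (by simp) _ _
  · rw [Set.disjoint_union_left, Set.disjoint_union_right, Set.disjoint_union_right]
    refine ⟨⟨?_, ?_⟩, ?_, ?_⟩ <;> exact snocP_disj _ _ _ _ (by simp) _ _

theorem Aset_zero (i j : ℤ) : (Aset 0 i j).ncard = if i = 0 ∧ j = 0 then 1 else 0 := by
  split_ifs with h
  · rw [Set.ncard_eq_one]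
    refine ⟨([], []), ?_⟩
    ext ⟨u, v⟩
    obtain ⟨rfl, rfl⟩ := h
    simp only [Aset, Set.mem_ofPred_eq, List.length_eq_zero_iff, Set.mem_singleton_iff,
      Prod.mk.injEq]
    constructor
    · rintro ⟨h1, h2, _⟩; exact ⟨h1, h2⟩
    · rintro ⟨rfl, rfl⟩
      exact ⟨rfl, rfl, rfl, rfl, fun t h1 h2 => by omega⟩
  · rw [Set.ncard_eq_zero (Aset_fin _ _ _)]
    ext ⟨u, v⟩
    simp only [Aset, Set.mem_ofPred_eq, List.length_eq_zero_iff, Set.mem_empty_iff_false, iff_false]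
    rintro ⟨rfl, rfl, h3, h4, _⟩
    exact h ⟨by simpa using h3.symm, by simpa using h4.symm⟩

theorem Aset_diag (m : ℕ) (i : ℤ) : (Aset (m + 1) i i).ncard = 0 := by
  rw [Set.ncard_eq_zero (Aset_fin _ _ _)]
  ext ⟨u, v⟩
  simp only [Aset, Set.mem_ofPred_eq, Set.mem_empty_iff_false, iff_false]
  rintro ⟨h1, h2, h3, h4, h5⟩
  apply h5 (m + 1) (by omega) le_rfl
  rw [List.take_of_length_le (l := u) (by omega), List.take_of_length_le (l := v) (by omega),
    abEq_iff _ _ (by omega)]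
  omega

theorem Aset_card (n : ℕ) (i j : ℤ) (hij : j ≤ i) :
    ((Aset (n + 1) i j).ncard : ℤ) = cz n (i - 1) * cz n j - cz n i * cz n (j - 1) := by
  induction n generalizing i j with
  | zero =>
    rcases eq_or_lt_of_le hij with rfl | h
    · rw [Aset_diag]; push_cast; ring
    · rw [Aset_card_succ _ _ _ h.ne']
      simp only [Aset_zero, cz]
      split_ifs <;> first | omega | simp
  | succ n ih =>
    rcases eq_or_lt_of_le hij with rfl | h
    · rw [Aset_diag]; push_cast; ring
    · rw [Aset_card_succ _ _ _ h.ne']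
      push_cast
      rw [ih i j hij, ih (i - 1) j (by omega), ih i (j - 1) (by omega),
        ih (i - 1) (j - 1) (by omega)]
      simp only [cz]
      ring

theorem stmt_9 (m l1 l2 : ℕ) (hm : 1 ≤ m) (hl : l2 < l1) (hl1 : l1 ≤ m) :
    ({p : List Bool × List Bool | p.1.length = m ∧ p.2.length = m ∧
        p.1.count true = l1 ∧ p.2.count true = l2 ∧
        ∀ t, 1 ≤ t → t ≤ m → ¬ AbEq (p.1.take t) (p.2.take t)}.ncard : ℚ)
      = (((l1 : ℚ) - (l2 : ℚ)) / (m : ℚ)) * (m.choose l1 : ℚ) * (m.choose l2 : ℚ) := by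
  obtain ⟨n, rfl⟩ : ∃ n, m = n + 1 := ⟨m - 1, by omega⟩
  obtain ⟨k, rfl⟩ : ∃ k, l1 = k + 1 := ⟨l1 - 1, by omega⟩
  have h := Aset_card n ((k + 1 : ℕ) : ℤ) (l2 : ℤ) (by omega)
  simp only [Aset, Nat.cast_inj] at h
  have h' := congrArg (fun z : ℤ => (z : ℚ)) h
  simp only [Int.cast_natCast] at h'
  rw [h']
  have hn : ((n + 1 : ℕ) : ℚ) ≠ 0 := by positivity
  rw [show ((k + 1 : ℕ) : ℤ) - 1 = (k : ℤ) by push_cast; ring, cz_nat, cz_nat, cz_nat]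
  have a1 : ((n : ℚ) + 1) * n.choose k = (n + 1).choose (k + 1) * (k + 1) := by
    exact_mod_cast Nat.add_one_mul_choose_eq n k
  have p1 : ((n + 1).choose (k + 1) : ℚ) = n.choose k + n.choose (k + 1) := by
    exact_mod_cast Nat.choose_succ_succ n k
  rw [div_mul_eq_mul_div, div_mul_eq_mul_div, eq_div_iff hn]
  cases l2 with
  | zero =>
    rw [cz_neg _ _ (by simp)]
    push_cast
    simp only [Nat.choose_zero_right, Nat.cast_one]
    linear_combination a1
  | succ j =>
    rw [show ((j + 1 : ℕ) : ℤ) - 1 = (j : ℤ) by push_cast; ring, cz_nat]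
    have a2 : ((n : ℚ) + 1) * n.choose j = (n + 1).choose (j + 1) * (j + 1) := by
      exact_mod_cast Nat.add_one_mul_choose_eq n j
    have p2 : ((n + 1).choose (j + 1) : ℚ) = n.choose j + n.choose (j + 1) := by
      exact_mod_cast Nat.choose_succ_succ n j
    push_cast
    linear_combination ((n + 1).choose (j + 1) : ℚ) * a1 - ((n + 1).choose (k + 1) : ℚ) * a2
      - ((n : ℚ) + 1) * n.choose k * p2 + ((n : ℚ) + 1) * n.choose j * p1
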